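/- Let C be a sorting network on n channels of depth d. Then there exists a sorting network N on n channels of depth d whose last layer (i) only contains comparators of the form (i,i+1) between adjacent channels, and (ii) does not contain two adjacent channels that are both unused in the last layer. -/

import Mathlib

/-- Apply one parallel layer of comparators to a 0/1 vector (Bool: false = 0, true = 1):
each comparator `(i,j)` puts the minimum on channel `i` and the maximum on channel `j`. -/
def applyLayer {n : ℕ} (L : Finset (Fin n × Fin n)) (x : Fin n → Bool) : Fin n → Bool :=
  fun c => (x c && decide (∀ j, (c, j) ∈ L → x j = true)) ||
           decide (∃ i, (i, c) ∈ L ∧ x i = true)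

/-- Apply a comparator network (a list of layers) to a 0/1 vector, layer by layer. -/
def applyNet {n : ℕ} (C : List (Finset (Fin n × Fin n))) (x : Fin n → Bool) : Fin n → Bool :=
  C.foldl (fun v L => applyLayer L v) x

/-- A valid layer: each comparator `(i,j)` has `i < j`, and every channel appears
in at most one comparator of the layer. -/
def ValidLayer {n : ℕ} (L : Finset (Fin n × Fin n)) : Prop :=
  (∀ p ∈ L, p.1 < p.2) ∧
  ∀ p ∈ L, ∀ q ∈ L, p ≠ q → p.1 ≠ q.1 ∧ p.1 ≠ q.2 ∧ p.2 ≠ q.1 ∧ p.2 ≠ q.2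

/-- A valid comparator network: every layer is valid. -/
def ValidNet {n : ℕ} (C : List (Finset (Fin n × Fin n))) : Prop :=
  ∀ L ∈ C, ValidLayer L

/-- A 0/1 vector is sorted in ascending order. -/
def SortedVec {n : ℕ} (x : Fin n → Bool) : Prop :=
  ∀ i j : Fin n, i ≤ j → x i ≤ x j

/-- A sorting network: a valid network sorting every 0/1 input. -/
def SortingNet {n : ℕ} (C : List (Finset (Fin n × Fin n))) : Prop :=
  ValidNet C ∧ ∀ x : Fin n → Bool, SortedVec (applyNet C x)

/-- Channel `c` is used in layer `L`. -/
def UsedIn {n : ℕ} (c : Fin n) (L : Finset (Fin n × Fin n)) : Prop :=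
  ∃ q ∈ L, q.1 = c ∨ q.2 = c

/-- A network of depth `d ≥ 1` is in last layer normal form: every comparator of the last
layer is of the form `(i,i+1)`, and no two adjacent channels are both unused in the last
layer. -/
def LLNF {n : ℕ} (C : List (Finset (Fin n × Fin n))) : Prop :=
  (∀ p ∈ C.getD (C.length - 1) ∅, (p.2 : ℕ) = (p.1 : ℕ) + 1) ∧
  (∀ i j : Fin n, (j : ℕ) = (i : ℕ) + 1 →
    UsedIn i (C.getD (C.length - 1) ∅) ∨ UsedIn j (C.getD (C.length - 1) ∅))

theorem ble_iff : ∀ a b : Bool, a ≤ b ↔ (a = true → b = true) := by decide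

theorem blt_iff : ∀ a b : Bool, a < b ↔ (a = false ∧ b = true) := by decide

theorem al_true {n : ℕ} (L : Finset (Fin n × Fin n)) (x : Fin n → Bool) (c : Fin n) :
    applyLayer L x c = true ↔
      (x c = true ∧ ∀ j, (c, j) ∈ L → x j = true) ∨ ∃ i, (i, c) ∈ L ∧ x i = true := by
  simp [applyLayer]

theorem valid_uniq {n : ℕ} {L : Finset (Fin n × Fin n)} (hL : ValidLayer L) {a b c d : Fin n}
    (h1 : (a, b) ∈ L) (h2 : (c, d) ∈ L) (h : a = c ∨ a = d ∨ b = c ∨ b = d) :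
    a = c ∧ b = d := by
  by_contra hne
  have := hL.2 _ h1 _ h2 (by simpa using hne)
  simp only [ne_eq] at this
  tauto

theorem al_fst {n : ℕ} {L : Finset (Fin n × Fin n)} (hL : ValidLayer L) (x : Fin n → Bool)
    {i j : Fin n} (h : (i, j) ∈ L) : applyLayer L x i = (x i && x j) := by
  rw [Bool.eq_iff_iff, al_true]
  have hij : i < j := hL.1 _ h
  simp only [Bool.and_eq_true]
  constructor
  · rintro (⟨h1, h2⟩ | ⟨k, hk, _⟩)
    · exact ⟨h1, h2 _ h⟩
    · have := valid_uniq hL hk h (by simp)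
      omega
  · rintro ⟨h1, h2⟩
    left
    refine ⟨h1, fun k hk => ?_⟩
    rw [(valid_uniq hL hk h (by simp)).2]
    exact h2

theorem al_snd {n : ℕ} {L : Finset (Fin n × Fin n)} (hL : ValidLayer L) (x : Fin n → Bool)
    {i j : Fin n} (h : (i, j) ∈ L) : applyLayer L x j = (x i || x j) := by
  rw [Bool.eq_iff_iff, al_true]
  have hij : i < j := hL.1 _ h
  simp only [Bool.or_eq_true]
  constructor
  · rintro (⟨h1, h2⟩ | ⟨k, hk, hx⟩)
    · exact Or.inr h1
    · rw [(valid_uniq hL hk h (by simp)).1] at hx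
      exact Or.inl hx
  · rintro (h1 | h1)
    · exact Or.inr ⟨i, h, h1⟩
    · left
      refine ⟨h1, fun k hk => ?_⟩
      have := valid_uniq hL hk h (by simp)
      omega

theorem al_unused {n : ℕ} {L : Finset (Fin n × Fin n)} (x : Fin n → Bool)
    {c : Fin n} (h : ¬ UsedIn c L) : applyLayer L x c = x c := by
  rw [Bool.eq_iff_iff, al_true]
  have h1 : ∀ j, (c, j) ∉ L := fun j hj => h ⟨_, hj, Or.inl rfl⟩
  have h2 : ∀ j, (j, c) ∉ L := fun j hj => h ⟨_, hj, Or.inr rfl⟩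
  simp [h1, h2]

theorem used_cases {n : ℕ} (L : Finset (Fin n × Fin n)) (c : Fin n) :
    ¬ UsedIn c L ∨ (∃ j, (c, j) ∈ L) ∨ (∃ i, (i, c) ∈ L) := by
  by_cases h : UsedIn c L
  · obtain ⟨⟨a, b⟩, hq, h | h⟩ := h
    · simp only at h; subst h; exact Or.inr (Or.inl ⟨_, hq⟩)
    · simp only at h; subst h; exact Or.inr (Or.inr ⟨_, hq⟩)
  · exact Or.inl h

theorem valid_subset {n : ℕ} {L L' : Finset (Fin n × Fin n)} (hL : ValidLayer L)
    (hs : L' ⊆ L) : ValidLayer L' :=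
  ⟨fun p hp => hL.1 p (hs hp), fun p hp q hq => hL.2 p (hs hp) q (hs hq)⟩

theorem al_drop {n : ℕ} {L L' : Finset (Fin n × Fin n)} (hL : ValidLayer L) (hs : L' ⊆ L)
    (y : Fin n → Bool)
    (hy : ∀ i j, (i, j) ∈ L → (i, j) ∉ L' → y i = true → y j = true) :
    applyLayer L' y = applyLayer L y := by
  funext c
  have hL' := valid_subset hL hs
  rcases used_cases L c with h | ⟨j, h⟩ | ⟨i, h⟩
  · have h' : ¬ UsedIn c L' := fun ⟨q, hq, hc⟩ => h ⟨q, hs hq, hc⟩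
    rw [al_unused y h, al_unused y h']
  · by_cases hm : (c, j) ∈ L'
    · rw [al_fst hL y h, al_fst hL' y hm]
    · have h' : ¬ UsedIn c L' := by
        rintro ⟨⟨a, b⟩, hq, hc⟩
        obtain ⟨rfl, rfl⟩ := valid_uniq hL (hs hq) h (by rcases hc with hc | hc <;> simp_all)
        exact hm hq
      rw [al_unused y h', al_fst hL y h]
      have := hy _ _ h hm
      cases hc : y c <;> simp_all
  · by_cases hm : (i, c) ∈ L'
    · rw [al_snd hL y h, al_snd hL' y hm]
    · have h' : ¬ UsedIn c L' := by
        rintro ⟨⟨a, b⟩, hq, hc⟩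
        obtain ⟨rfl, rfl⟩ := valid_uniq hL (hs hq) h (by rcases hc with hc | hc <;> simp_all)
        exact hm hq
      rw [al_unused y h', al_snd hL y h]
      have := hy _ _ h hm
      cases hc : y i <;> simp_all

theorem al_sorted {n : ℕ} {L : Finset (Fin n × Fin n)} (hL : ValidLayer L)
    {x : Fin n → Bool} (hx : SortedVec x) : applyLayer L x = x := by
  rw [← al_drop hL (Finset.empty_subset L) x
    (fun i j h _ hi => by
      have := hx i j (hL.1 _ h).le
      exact (ble_iff _ _).1 this hi)]
  funext c
  exact al_unused x (by simp [UsedIn])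

theorem net_sorted {n : ℕ} (P : List (Finset (Fin n × Fin n))) (hP : ValidNet P)
    {x : Fin n → Bool} (hx : SortedVec x) : applyNet P x = x := by
  induction P with
  | nil => rfl
  | cons L P ih =>
    have : applyNet (L :: P) x = applyNet P (applyLayer L x) := rfl
    rw [this, al_sorted (hP L (by simp)) hx]
    exact ih (fun M hM => hP M (by simp [hM]))

theorem al_mono {n : ℕ} (L : Finset (Fin n × Fin n)) {x y : Fin n → Bool}
    (h : ∀ c, x c = true → y c = true) (c : Fin n) :
    applyLayer L x c = true → applyLayer L y c = true := by
  rw [al_true, al_true]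
  rintro (⟨h1, h2⟩ | ⟨k, hk, hx⟩)
  · exact Or.inl ⟨h _ h1, fun j hj => h _ (h2 j hj)⟩
  · exact Or.inr ⟨k, hk, h _ hx⟩

theorem net_mono {n : ℕ} (P : List (Finset (Fin n × Fin n))) :
    ∀ {x y : Fin n → Bool} (_ : ∀ c, x c = true → y c = true) (c : Fin n),
    applyNet P x c = true → applyNet P y c = true := by
  induction P with
  | nil => intro x y h c; exact h c
  | cons L P ih => intro x y h c; exact ih (al_mono L h) c

def zeros {n : ℕ} (x : Fin n → Bool) : ℕ := (Finset.univ.filter (fun c => x c = false)).card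

theorem zeros_comp {n : ℕ} (x : Fin n → Bool) (f : Fin n → Fin n) (hf : Function.Involutive f) :
    zeros (fun c => x (f c)) = zeros x := by
  unfold zeros
  refine Finset.card_bij (fun c _ => f c) ?_ ?_ ?_
  · intro a ha; simpa using ha
  · intro a _ b _ h; exact hf.injective h
  · intro b hb; exact ⟨f b, by simpa [hf b] using hb, hf b⟩

open Classical in
theorem al_zeros {n : ℕ} {L : Finset (Fin n × Fin n)} (hL : ValidLayer L)
    (x : Fin n → Bool) : zeros (applyLayer L x) = zeros x := by
  have key : ∀ c, ∃ d, applyLayer L x c = x d ∧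
      ((d = c ∧ (∀ k, (c, k) ∈ L → ¬ (x c = true ∧ x k = false)) ∧
          (∀ k, (k, c) ∈ L → ¬ (x k = true ∧ x c = false))) ∨
        ((c, d) ∈ L ∧ x c = true ∧ x d = false) ∨
        ((d, c) ∈ L ∧ x d = true ∧ x c = false)) := by
    intro c
    by_cases h1 : ∃ k, (c, k) ∈ L ∧ x c = true ∧ x k = false
    · obtain ⟨k, hk, h2, h3⟩ := h1
      exact ⟨k, by rw [al_fst hL x hk]; simp [h2, h3], Or.inr (Or.inl ⟨hk, h2, h3⟩)⟩
    by_cases h2 : ∃ k, (k, c) ∈ L ∧ x k = true ∧ x c = false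
    · obtain ⟨k, hk, h2, h3⟩ := h2
      exact ⟨k, by rw [al_snd hL x hk]; simp [h2, h3], Or.inr (Or.inr ⟨hk, h2, h3⟩)⟩
    refine ⟨c, ?_, Or.inl ⟨rfl, fun k hk h => h1 ⟨k, hk, h⟩, fun k hk h => h2 ⟨k, hk, h⟩⟩⟩
    rcases used_cases L c with h | ⟨j, h⟩ | ⟨i, h⟩
    · exact al_unused x h
    · rw [al_fst hL x h]
      have := fun h' => h1 ⟨j, h, h'⟩
      cases hc : x c <;> cases hj : x j <;> simp_all
    · rw [al_snd hL x h]
      have := fun h' => h2 ⟨i, h, h'⟩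
      cases hc : x c <;> cases hj : x i <;> simp_all
  choose f hf hf' using key
  have hinv : Function.Involutive f := by
    intro c
    rcases hf' c with ⟨h, _⟩ | ⟨h, h1, h2⟩ | ⟨h, h1, h2⟩
    · rw [h, h]
    · rcases hf' (f c) with ⟨_, _, h4⟩ | ⟨_, h4, _⟩ | ⟨h3, _⟩
      · exact absurd ⟨h1, h2⟩ (h4 _ h)
      · simp_all
      · exact (valid_uniq hL h3 h (by simp)).1
    · rcases hf' (f c) with ⟨_, h4, _⟩ | ⟨h3, _⟩ | ⟨_, _, h4⟩
      · exact absurd ⟨h1, h2⟩ (h4 _ h)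
      · exact (valid_uniq hL h3 h (by simp)).2
      · simp_all
  rw [← zeros_comp x f hinv]
  congr 1
  funext c
  exact hf c

theorem net_zeros {n : ℕ} (P : List (Finset (Fin n × Fin n))) (hP : ValidNet P) :
    ∀ x : Fin n → Bool, zeros (applyNet P x) = zeros x := by
  induction P with
  | nil => intro x; rfl
  | cons L P ih =>
    intro x
    have : applyNet (L :: P) x = applyNet P (applyLayer L x) := rfl
    rw [this, ih (fun M hM => hP M (by simp [hM])), al_zeros (hP L (by simp))]

theorem sorted_zeros {n : ℕ} {z : Fin n → Bool} (hz : SortedVec z) (i : Fin n) :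
    z i = false ↔ (i : ℕ) < zeros z := by
  constructor
  · intro h
    have : (Finset.Iic i).card ≤ zeros z := by
      apply Finset.card_le_card
      intro k hk
      have := hz k i (by simpa using hk)
      rw [ble_iff, h] at this
      simpa using this
    rw [Fin.card_Iic] at this
    omega
  · intro h
    by_contra hc
    have : zeros z ≤ (Finset.Iio i).card := by
      apply Finset.card_le_card
      intro k hk
      rw [Finset.mem_Iio]
      by_contra hki
      have := (ble_iff _ _).1 (hz i k (not_lt.mp hki))
      simp_all
    rw [Fin.card_Iio] at this
    omega

theorem net_snoc {n : ℕ} (P : List (Finset (Fin n × Fin n))) (L : Finset (Fin n × Fin n))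
    (x : Fin n → Bool) : applyNet (P ++ [L]) x = applyLayer L (applyNet P x) := by
  simp [applyNet]

section main
variable {n : ℕ} {P : List (Finset (Fin n × Fin n))} {L : Finset (Fin n × Fin n)}

theorem bad_xor (hP : ValidNet P) (hL : ValidLayer L)
    (hs : ∀ x, SortedVec (applyLayer L (applyNet P x))) {i j : Fin n} (hij : (i, j) ∈ L)
    (x : Fin n → Bool) :
    ((applyNet P x i && applyNet P x j) = false ↔ (i : ℕ) < zeros x) ∧
    ((applyNet P x i || applyNet P x j) = false ↔ (j : ℕ) < zeros x) := by
  have h := sorted_zeros (hs x)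
  rw [al_zeros hL, net_zeros P hP] at h
  exact ⟨by rw [← al_fst hL _ hij]; exact h i, by rw [← al_snd hL _ hij]; exact h j⟩

def Bad (P : List (Finset (Fin n × Fin n))) (i j : Fin n) (x : Fin n → Bool) : Prop :=
  applyNet P x i = true ∧ applyNet P x j = false

theorem bad_up (hP : ValidNet P) (hL : ValidLayer L)
    (hs : ∀ x, SortedVec (applyLayer L (applyNet P x))) {i j : Fin n} (hij : (i, j) ∈ L)
    {x x' : Fin n → Bool} (hx : Bad P i j x) (h : ∀ c, x c = true → x' c = true)
    (hz : (i : ℕ) < zeros x') : Bad P i j x' := by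
  have h1 := net_mono P h i hx.1
  have h2 := (bad_xor hP hL hs hij x').1.2 hz
  exact ⟨h1, by simpa [h1] using h2⟩

theorem bad_down (hP : ValidNet P) (hL : ValidLayer L)
    (hs : ∀ x, SortedVec (applyLayer L (applyNet P x))) {i j : Fin n} (hij : (i, j) ∈ L)
    {x x' : Fin n → Bool} (hx : Bad P i j x) (h : ∀ c, x' c = true → x c = true)
    (hz : zeros x' ≤ (j : ℕ)) : Bad P i j x' := by
  have h1 : applyNet P x' j = false := by
    by_contra hc
    have := net_mono P h j (by simpa using hc)
    simp [hx.2] at this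
  have h2 := mt (bad_xor hP hL hs hij x').2.1 (by omega)
  exact ⟨by simpa [h1] using h2, h1⟩

theorem zeros_set_true (x : Fin n → Bool) (b : Fin n) (hb : x b = false) :
    zeros (Function.update x b true) + 1 = zeros x := by
  unfold zeros
  have : (Finset.univ.filter (fun c => Function.update x b true c = false))
      = (Finset.univ.filter (fun c => x c = false)).erase b := by
    ext c
    by_cases h : c = b <;> simp [Function.update_apply, h]
  rw [this, Finset.card_erase_add_one (by simpa using hb)]

theorem zeros_set_false (x : Fin n → Bool) (b : Fin n) (hb : x b = true) :
    zeros (Function.update x b false) = zeros x + 1 := by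
  have := zeros_set_true (Function.update x b false) b (by simp)
  simp only [Function.update_idem] at this
  rw [← this]
  congr 2
  funext c
  by_cases h : c = b <;> simp [Function.update_apply, h, hb]

def wt (x : Fin n → Bool) : ℕ := ∑ c, if x c = true then (c : ℕ) else 0

theorem wt_swap (x : Fin n → Bool) {a b : Fin n} (hab : a < b) (ha : x a = true)
    (hb : x b = false) :
    wt x < wt (Function.update (Function.update x a false) b true) := by
  unfold wt
  have h1 : ∀ (y : Fin n → Bool), ∑ c, (if y c = true then (c : ℕ) else 0) =
      (if y a = true then (a : ℕ) else 0) + ((if y b = true then (b : ℕ) else 0) +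
        ∑ c ∈ (Finset.univ.erase a).erase b, if y c = true then (c : ℕ) else 0) := by
    intro y
    rw [Finset.add_sum_erase _ (fun c : Fin n => if y c = true then (c : ℕ) else 0)
        (show b ∈ Finset.univ.erase a by simp [hab.ne']),
      Finset.add_sum_erase _ (fun c : Fin n => if y c = true then (c : ℕ) else 0)
        (Finset.mem_univ a)]
  rw [h1 x, h1]
  have h2 : ∑ c ∈ (Finset.univ.erase a).erase b,
      (if Function.update (Function.update x a false) b true c = true then (c : ℕ) else 0)
      = ∑ c ∈ (Finset.univ.erase a).erase b, if x c = true then (c : ℕ) else 0 := by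
    refine Finset.sum_congr rfl fun c hc => ?_
    simp only [Finset.mem_erase] at hc
    simp [Function.update_apply, hc.1, hc.2.1]
  rw [h2]
  simp [Function.update_apply, hab.ne, ha, hb]
  exact hab

theorem not_bad (hP : ValidNet P) (hL : ValidLayer L)
    (hs : ∀ x, SortedVec (applyLayer L (applyNet P x))) {i j : Fin n} (hij : (i, j) ∈ L)
    (hne : (j : ℕ) ≠ (i : ℕ) + 1) (x : Fin n → Bool) : ¬ Bad P i j x := by
  classical
  intro hx
  have hlt : (i : ℕ) < j := hL.1 _ hij
  obtain ⟨x, hx, hmax⟩ := Finset.exists_max_image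
    (Finset.univ.filter (fun x => Bad P i j x)) wt ⟨x, by simpa using hx⟩
  simp only [Finset.mem_filter, Finset.mem_univ, true_and] at hx hmax
  by_cases hsx : SortedVec x
  · unfold Bad at hx
    rw [net_sorted P hP hsx] at hx
    have := (ble_iff _ _).1 (hsx i j (hL.1 _ hij).le)
    simp_all
  · unfold SortedVec at hsx
    push Not at hsx
    obtain ⟨a, b, hab, hlt'⟩ := hsx
    obtain ⟨hb, ha⟩ := (blt_iff _ _).1 hlt'
    have hab' : a < b := lt_of_le_of_ne hab (by rintro rfl; simp_all)
    have hz1 := (bad_xor hP hL hs hij x).1.1 (by simp [hx.2])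
    have hz2 : zeros x ≤ (j : ℕ) := by
      have := mt (bad_xor hP hL hs hij x).2.2 (by simp [hx.1])
      omega
    have hw := wt_swap x hab' ha hb
    refine absurd (hmax _ ?_) (not_le.mpr hw)
    have e1 := zeros_set_false x a ha
    have e2 := zeros_set_true (Function.update x a false) b
      (by simp [Function.update_apply, hb])
    have e3 := zeros_set_true x b hb
    by_cases hj : zeros x < j
    · have h1 : Bad P i j (Function.update x a false) := by
        refine bad_down hP hL hs hij hx ?_ (by omega)
        intro c; by_cases h : c = a <;> simp [Function.update_apply, h]
      refine bad_up hP hL hs hij h1 ?_ (by omega)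
      intro c; by_cases h : c = b <;> simp [Function.update_apply, h]
    · have h1 : Bad P i j (Function.update x b true) := by
        refine bad_up hP hL hs hij hx ?_ (by omega)
        intro c; by_cases h : c = b <;> simp [Function.update_apply, h]
      refine bad_down hP hL hs hij h1 ?_ (by omega)
      intro c; by_cases h : c = b <;> by_cases h' : c = a <;> simp_all [Function.update_apply]

end main

/-- every sorting network of depth `d` can be turned into a sorting network
of the same depth in last layer normal form. -/
theorem exists_llnf_sorting_network {n : ℕ}
    (C : List (Finset (Fin n × Fin n))) (hC : SortingNet C) :
    ∃ N : List (Finset (Fin n × Fin n)),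
      N.length = C.length ∧ SortingNet N ∧ LLNF N := by
  classical
  rcases List.eq_nil_or_concat C with rfl | ⟨P, L, rfl⟩
  · refine ⟨[], rfl, hC, by simp, ?_⟩
    intro i j hij
    exfalso
    have := hC.2 (fun c => decide (c = i)) i j (Fin.le_def.mpr (by omega))
    have hne : j ≠ i := by rintro rfl; omega
    rw [ble_iff] at this
    simp [applyNet, hne] at this
  · rw [List.concat_eq_append] at hC ⊢
    have hP : ValidNet P := fun M hM => hC.1 M (by simp [hM])
    have hL : ValidLayer L := hC.1 L (by simp)
    have hs : ∀ x, SortedVec (applyLayer L (applyNet P x)) := fun x => by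
      rw [← net_snoc]; exact hC.2 x
    let S : Finset (Finset (Fin n × Fin n)) := Finset.univ.filter (fun M =>
      ValidLayer M ∧ (∀ p ∈ M, (p.2 : ℕ) = (p.1 : ℕ) + 1) ∧
        ∀ x, SortedVec (applyLayer M (applyNet P x)))
    have hS : (L.filter (fun p => (p.2 : ℕ) = (p.1 : ℕ) + 1)) ∈ S := by
      simp only [S, Finset.mem_filter, Finset.mem_univ, true_and]
      refine ⟨valid_subset hL (Finset.filter_subset _ _), fun p hp => hp.2, fun x => ?_⟩
      rw [al_drop hL (Finset.filter_subset _ _)]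
      · exact hs x
      · intro i j hij hn hi
        have hne : (j : ℕ) ≠ (i : ℕ) + 1 := fun h => hn (by simp [hij, h])
        by_contra hj
        exact not_bad hP hL hs hij hne x ⟨hi, by simpa using hj⟩
    obtain ⟨M, hM, hmax⟩ := Finset.exists_max_image S Finset.card ⟨_, hS⟩
    simp only [S, Finset.mem_filter, Finset.mem_univ, true_and] at hM hmax
    obtain ⟨hMv, hMa, hMs⟩ := hM
    refine ⟨P ++ [M], by simp, ⟨?_, fun x => by rw [net_snoc]; exact hMs x⟩, ?_⟩
    · intro K hK
      rcases List.mem_append.mp hK with h | h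
      · exact hP K h
      · rw [List.mem_singleton.mp h]; exact hMv
    · have hg : (P ++ [M]).getD ((P ++ [M]).length - 1) ∅ = M := by simp
      unfold LLNF
      rw [hg]
      refine ⟨hMa, fun i j hij => ?_⟩
      by_contra hu
      push Not at hu
      obtain ⟨hi, hj⟩ := hu
      have hlt : i < j := Fin.lt_def.mpr (by omega)
      have hnot : (i, j) ∉ M := fun h => hi ⟨_, h, Or.inl rfl⟩
      have hi1 : ∀ q ∈ M, i ≠ q.1 ∧ i ≠ q.2 := fun q hq =>
        ⟨fun h => hi ⟨q, hq, Or.inl h.symm⟩, fun h => hi ⟨q, hq, Or.inr h.symm⟩⟩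
      have hj1 : ∀ q ∈ M, j ≠ q.1 ∧ j ≠ q.2 := fun q hq =>
        ⟨fun h => hj ⟨q, hq, Or.inl h.symm⟩, fun h => hj ⟨q, hq, Or.inr h.symm⟩⟩
      have hv : ValidLayer (insert (i, j) M) := by
        refine ⟨?_, ?_⟩
        · intro p hp
          rcases Finset.mem_insert.mp hp with rfl | hp
          · exact hlt
          · exact hMv.1 p hp
        · intro p hp q hq hpq
          rcases Finset.mem_insert.mp hp with rfl | hp <;>
            rcases Finset.mem_insert.mp hq with rfl | hq
          · exact absurd rfl hpq
          · exact ⟨(hi1 q hq).1, (hi1 q hq).2, (hj1 q hq).1, (hj1 q hq).2⟩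
          · exact ⟨(hi1 p hp).1.symm, (hj1 p hp).1.symm, (hi1 p hp).2.symm, (hj1 p hp).2.symm⟩
          · exact hMv.2 p hp q hq hpq
      have := hmax (insert (i, j) M) ⟨hv, ?_, ?_⟩
      · rw [Finset.card_insert_of_notMem hnot] at this
        omega
      · intro p hp
        rcases Finset.mem_insert.mp hp with rfl | hp
        · exact hij
        · exact hMa p hp
      · intro x
        rw [← al_drop hv (Finset.subset_insert _ _)]
        · exact hMs x
        · intro a b hab hn ha
          rcases Finset.mem_insert.mp hab with h | h
          · obtain ⟨rfl, rfl⟩ := Prod.mk.inj h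
            have := hMs x a b hlt.le
            rw [al_unused _ hi, al_unused _ hj, ble_iff] at this
            exact this ha
          · exact absurd h hn
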